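/- (Modular equation of level two for U.) For every τ ∈ ℍ, one has U(τ)⁴ + 4U(τ)²U(2τ)² + U(2τ)⁴ = U(2τ)²·(1 + 5U(τ)⁴). -/

import Mathlib

open Complex

/-- The `q`-Pochhammer infinite product `(a; q)∞ = ∏_{n=0}^∞ (1 - a qⁿ)`. -/
noncomputable def qPoch (a q : ℂ) : ℂ := ∏' n : ℕ, (1 - a * q ^ n)

/-- The nome `q = e^{2πiτ}` of a point `τ` of the upper half-plane. -/
noncomputable def Qc (τ : UpperHalfPlane) : ℂ := Complex.exp (2 * Real.pi * Complex.I * τ)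


/-- `U(τ) = q^{1/2}·(q;q)∞(q¹⁰;q¹⁰)∞² / ((q²;q²)∞²(q⁵;q⁵)∞)` with `q^{1/2} = e^{πiτ}`;
this is the η-quotient `η(τ)η(10τ)²/(η(2τ)²η(5τ))`. -/
noncomputable def Ufun (τ : UpperHalfPlane) : ℂ :=
  Complex.exp (Real.pi * Complex.I * τ) *
    (qPoch (Qc τ) (Qc τ) * qPoch (Qc τ ^ 10) (Qc τ ^ 10) ^ 2) /
    (qPoch (Qc τ ^ 2) (Qc τ ^ 2) ^ 2 * qPoch (Qc τ ^ 5) (Qc τ ^ 5))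


/-- The point `2τ` of the upper half-plane. -/
noncomputable def dbl (τ : UpperHalfPlane) : UpperHalfPlane := ⟨2 * (τ : ℂ), by simpa using τ.2⟩


namespace ThetaAux

open Filter Topology

/-! ### q-Pochhammer products -/

lemma summable_geo (a : ℂ) {q : ℂ} (hq : ‖q‖ < 1) : Summable fun n : ℕ => ‖-(a * q ^ n)‖ := by
  simp only [norm_neg, norm_mul, norm_pow]
  exact (summable_geometric_of_lt_one (norm_nonneg _) hq).mul_left _

lemma mult_poch (a : ℂ) {q : ℂ} (hq : ‖q‖ < 1) : Multipliable fun n : ℕ => (1 - a * q ^ n) := by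
  simpa [sub_eq_add_neg] using multipliable_one_add_of_summable (summable_geo a hq)

lemma poch_ne_zero (a : ℂ) {q : ℂ} (hq : ‖q‖ < 1) (h : ∀ n : ℕ, 1 - a * q ^ n ≠ 0) :
    qPoch a q ≠ 0 := by
  have := tprod_one_add_ne_zero_of_summable (f := fun n : ℕ => -(a * q ^ n))
    (by simpa [sub_eq_add_neg] using h) (summable_geo a hq)
  simpa [qPoch, sub_eq_add_neg] using this

lemma poch_ne_zero_of_norm {a : ℂ} {q : ℂ} (ha : ‖a‖ < 1) (hq : ‖q‖ < 1) : qPoch a q ≠ 0 := by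
  refine poch_ne_zero a hq fun n h => ?_
  have h1 : a * q ^ n = 1 := (sub_eq_zero.mp h).symm
  have h2 : ‖a‖ * ‖q‖ ^ n = 1 := by rw [← norm_pow, ← norm_mul, h1, norm_one]
  have h3 : ‖q‖ ^ n ≤ 1 := pow_le_one₀ (norm_nonneg _) hq.le
  nlinarith [norm_nonneg a, norm_nonneg q]

lemma norm_pow_lt {q : ℂ} (hq : ‖q‖ < 1) {n : ℕ} (hn : n ≠ 0) : ‖q ^ n‖ < 1 := by
  rw [norm_pow]; exact pow_lt_one₀ (norm_nonneg _) hq hn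

/-- splitting into even and odd indices -/
lemma poch_split (a : ℂ) {q : ℂ} (hq : ‖q‖ < 1) :
    qPoch a (q ^ 2) * qPoch (a * q) (q ^ 2) = qPoch a q := by
  have h2 := norm_pow_lt hq two_ne_zero
  have e1 := mult_poch a h2
  have e2 := mult_poch (a * q) h2
  unfold qPoch
  rw [← tprod_even_mul_odd (f := fun n : ℕ => 1 - a * q ^ n)]
  · congr 1
    · exact tprod_congr fun n => by rw [pow_mul]
    · exact tprod_congr fun n => by rw [← pow_mul]; ring
  · exact e1.congr fun n => by rw [pow_mul]
  · exact e2.congr fun n => by rw [← pow_mul]; ring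

lemma poch_neg_mul (a : ℂ) {q : ℂ} (hq : ‖q‖ < 1) :
    qPoch (-a) q * qPoch a q = qPoch (a ^ 2) (q ^ 2) := by
  unfold qPoch
  rw [← (mult_poch (-a) hq).tprod_mul (mult_poch a hq)]
  exact tprod_congr fun n => by ring

lemma poch_succ (a : ℂ) {q : ℂ} (hq : ‖q‖ < 1) :
    qPoch a q = (1 - a) * qPoch (a * q) q := by
  unfold qPoch
  have := mult_poch (a * q) hq
  rw [tprod_eq_zero_mul']
  · simp only [pow_zero, mul_one]
    congr 1
    exact tprod_congr fun n => by ring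
  · exact this.congr fun n => by ring

/-! ### Gaussian binomials -/

/-- Gaussian binomial coefficients. -/
noncomputable def gb (Q : ℂ) : ℕ → ℕ → ℂ
  | 0, 0 => 1
  | 0, _ + 1 => 0
  | _ + 1, 0 => 1
  | N + 1, k + 1 => gb Q N (k + 1) + Q ^ (N - k) * gb Q N k

/-- finite q-factorial -/
noncomputable def qf (Q : ℂ) (n : ℕ) : ℂ := ∏ k ∈ Finset.range n, (1 - Q * Q ^ k)

lemma gb_zero (Q : ℂ) (N : ℕ) : gb Q N 0 = 1 := by cases N <;> simp [gb]

lemma gb_gt (Q : ℂ) (N : ℕ) : ∀ k, N < k → gb Q N k = 0 := by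
  induction N with
  | zero => intro k hk; cases k with
    | zero => omega
    | succ k => simp [gb]
  | succ N ih => intro k hk; cases k with
    | zero => omega
    | succ k => simp [gb, ih (k + 1) (by omega), ih k (by omega)]

lemma qf_succ (Q : ℂ) (n : ℕ) : qf Q (n + 1) = qf Q n * (1 - Q ^ (n + 1)) := by
  rw [qf, Finset.prod_range_succ, pow_succ', qf]

lemma gb_mul (Q : ℂ) (N : ℕ) : ∀ k, k ≤ N → gb Q N k * (qf Q k * qf Q (N - k)) = qf Q N := by
  induction N with
  | zero => intro k hk; obtain rfl : k = 0 := by omega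
            simp [gb, qf]
  | succ N ih => intro k hk; cases k with
    | zero => simp [gb, qf]
    | succ k =>
      rw [gb]
      rcases Nat.lt_or_ge k N with h | h
      · obtain ⟨d, rfl⟩ : ∃ d, N = k + 1 + d := ⟨N - (k + 1), by omega⟩
        have h1 := ih (k + 1) (by omega)
        have h2 := ih k (by omega)
        rw [show k + 1 + d - (k + 1) = d by omega] at h1
        rw [show k + 1 + d - k = d + 1 by omega] at h2 ⊢
        rw [show k + 1 + d + 1 - (k + 1) = d + 1 by omega]
        rw [qf_succ Q (k + 1 + d)]
        have e1 := qf_succ Q d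
        have e2 := qf_succ Q k
        have e3 : Q ^ (k + 1 + d + 1) = Q ^ (d + 1) * Q ^ (k + 1) := by ring
        rw [e3]
        calc _ = (1 - Q ^ (d + 1)) * (gb Q (k + 1 + d) (k + 1) * (qf Q (k + 1) * qf Q d))
              + Q ^ (d + 1) * (1 - Q ^ (k + 1)) *
                (gb Q (k + 1 + d) k * (qf Q k * qf Q (d + 1))) := by
              rw [e1, e2]; ring
          _ = _ := by rw [h1, h2]; ring
      · obtain rfl : k = N := by omega
        have h2 := ih k le_rfl
        rw [gb_gt Q k (k + 1) (by omega)]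
        simp only [Nat.sub_self, pow_zero, zero_add, one_mul] at h2 ⊢
        rw [qf_succ]
        linear_combination (1 - Q ^ (k + 1)) * h2

lemma q_binomial (Q x : ℂ) (N : ℕ) : ∏ k ∈ Finset.range N, (1 + x * Q ^ k) =
    ∑ j ∈ Finset.range (N + 1), gb Q N j * (Q ^ (j.choose 2) * x ^ j) := by
  induction N with
  | zero => simp [gb]
  | succ N ih =>
    rw [Finset.prod_range_succ, ih, Finset.sum_range_succ' _ (N + 1)]
    have e : ∀ j ∈ Finset.range (N + 1),
        gb Q (N + 1) (j + 1) * (Q ^ ((j + 1).choose 2) * x ^ (j + 1)) =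
        gb Q N (j + 1) * (Q ^ ((j + 1).choose 2) * x ^ (j + 1)) +
          x * Q ^ N * (gb Q N j * (Q ^ (j.choose 2) * x ^ j)) := by
      intro j hj
      have hj' : j ≤ N := by simpa [Nat.lt_succ_iff] using hj
      have h1 : Q ^ N = Q ^ (N - j) * Q ^ j := by rw [← pow_add]; congr 1; omega
      have h2 : (j + 1).choose 2 = j + j.choose 2 := by
        rw [Nat.choose_succ_succ' j 1]; simp
      rw [gb, h2, h1, pow_add]; ring
    rw [Finset.sum_congr rfl e, Finset.sum_add_distrib, ← Finset.mul_sum]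
    have h3 := Finset.sum_range_succ' (fun j => gb Q N j * (Q ^ (j.choose 2) * x ^ j)) (N + 1)
    rw [Finset.sum_range_succ, gb_gt Q N (N + 1) (by omega)] at h3
    simp only [gb_zero] at h3 ⊢
    linear_combination h3

/-! ### summability of theta series -/

lemma summable_theta {q z : ℂ} (hq0 : q ≠ 0) (hq : ‖q‖ < 1) (hz : z ≠ 0) :
    Summable fun j : ℤ => q ^ (j ^ 2) * z ^ j := by
  have hpi : (Real.pi : ℂ) ≠ 0 := by exact_mod_cast Real.pi_ne_zero
  have hI := Complex.I_ne_zero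
  have h := (summable_jacobiTheta₂_term_iff (Complex.log z / (2 * Real.pi * Complex.I))
    (Complex.log q / (Real.pi * Complex.I))).mpr (by
      have : Complex.log q / (Real.pi * Complex.I) =
        ((1 / Real.pi : ℝ) : ℂ) * (-(Complex.I * Complex.log q)) := by
        push_cast; field_simp; simp
      rw [this, Complex.im_ofReal_mul]
      simp only [Complex.neg_im, Complex.mul_im, Complex.I_re, Complex.I_im, Complex.log_re]
      have : Real.log ‖q‖ < 0 := Real.log_neg (norm_pos_iff.mpr hq0) hq
      have hp := Real.pi_pos
      have : 0 < 1 / Real.pi * (-Real.log ‖q‖) := mul_pos (by positivity) (by linarith)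
      simpa using this)
  refine h.congr fun j => ?_
  rw [jacobiTheta₂_term, Complex.exp_add]
  conv_rhs => rw [← Complex.exp_log hq0, ← Complex.exp_log hz]
  rw [← Complex.exp_int_mul, ← Complex.exp_int_mul, mul_comm]
  congr 2
  · push_cast; field_simp
  · field_simp

/-! ### Jacobi triple product -/

lemma prod_odd (q z : ℂ) (hq0 : q ≠ 0) (n : ℕ) :
    ∏ k ∈ Finset.range n, (z * (q ^ (2 * k + 1))⁻¹) = z ^ n * (q ^ (n ^ 2))⁻¹ := by
  induction n with
  | zero => simp
  | succ n ih =>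
    rw [Finset.prod_range_succ, ih]
    have : q ^ ((n + 1) ^ 2) = q ^ (n ^ 2) * q ^ (2 * n + 1) := by rw [← pow_add]; congr 1; ring
    rw [this]; field_simp; ring

lemma finite_jtp {q z : ℂ} (hq0 : q ≠ 0) (hz : z ≠ 0) (n : ℕ) :
    (∏ k ∈ Finset.range n, (1 + z * q ^ (2 * k + 1))) *
      (∏ k ∈ Finset.range n, (1 + z⁻¹ * q ^ (2 * k + 1))) =
    ∑ i ∈ Finset.range (2 * n + 1), gb (q ^ 2) (2 * n) i *
      (q ^ (((i : ℤ) - n) ^ 2) * z ^ ((i : ℤ) - n)) := by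
  have h := q_binomial (q ^ 2) (z * q * ((q ^ 2) ^ n)⁻¹) (2 * n)
  rw [two_mul n, Finset.prod_range_add, ← Finset.prod_range_reflect, ← two_mul] at h
  have h1 : ∏ k ∈ Finset.range n, (1 + z * q * ((q ^ 2) ^ n)⁻¹ * (q ^ 2) ^ (n - 1 - k)) =
      z ^ n * (q ^ (n ^ 2))⁻¹ * ∏ k ∈ Finset.range n, (1 + z⁻¹ * q ^ (2 * k + 1)) := by
    rw [← prod_odd q z hq0, ← Finset.prod_mul_distrib]
    refine Finset.prod_congr rfl fun k hk => ?_
    have hk' : k < n := by simpa using hk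
    obtain ⟨d, rfl⟩ : ∃ d, n = k + 1 + d := ⟨n - (k + 1), by omega⟩
    rw [show k + 1 + d - 1 - k = d by omega]
    field_simp
    ring
  have h2 : ∏ k ∈ Finset.range n, (1 + z * q * ((q ^ 2) ^ n)⁻¹ * (q ^ 2) ^ (n + k)) =
      ∏ k ∈ Finset.range n, (1 + z * q ^ (2 * k + 1)) := by
    refine Finset.prod_congr rfl fun k hk => ?_
    rw [pow_add (q ^ 2) n k]
    field_simp
    ring
  rw [h1, h2] at h
  have h3 : (z ^ n * (q ^ (n ^ 2))⁻¹) ≠ 0 := by positivity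
  apply mul_left_cancel₀ h3
  rw [mul_comm (∏ k ∈ Finset.range n, (1 + z * q ^ (2 * k + 1))), ← mul_assoc, h, Finset.mul_sum]
  refine Finset.sum_congr rfl fun i hi => ?_
  have e1 : q ^ (((i : ℤ) - n) ^ 2) = q ^ (2 * i.choose 2) * q ^ i * q ^ (n ^ 2)
      * (q ^ (2 * n * i))⁻¹ := by
    have : ((i : ℤ) - n) ^ 2 = ((2 * i.choose 2 : ℕ) : ℤ) + i + (n ^ 2 : ℕ) - ((2 * n * i : ℕ) : ℤ) := by
      have h5 : 2 * i.choose 2 = i * (i - 1) := by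
        rw [Nat.choose_two_right, Nat.mul_div_cancel' (Nat.even_mul_pred_self i).two_dvd]
      have h6 : ((2 * i.choose 2 : ℕ) : ℤ) = i * (i - 1) := by
        rw [h5]; cases i <;> simp
      rw [h6]; push_cast; ring
    rw [this, zpow_sub₀ hq0, zpow_add₀ hq0, zpow_add₀ hq0]
    simp only [zpow_natCast]
    rw [div_eq_mul_inv]
  have e2 : z ^ ((i : ℤ) - n) = z ^ i * (z ^ n)⁻¹ := by
    rw [zpow_sub₀ hz, zpow_natCast, zpow_natCast, div_eq_mul_inv]
  rw [e1, e2, mul_pow, mul_pow, inv_pow, ← pow_mul, ← pow_mul, ← pow_mul,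
    ← mul_assoc 2 n i]
  field_simp

lemma qf_tendsto {Q : ℂ} (hQ : ‖Q‖ < 1) : Tendsto (qf Q) atTop (𝓝 (qPoch Q Q)) :=
  (mult_poch Q hQ).tendsto_prod_tprod_nat

lemma qf_ne_zero {Q : ℂ} (hQ : ‖Q‖ < 1) (n : ℕ) : qf Q n ≠ 0 := by
  refine Finset.prod_ne_zero_iff.mpr fun k _ h => ?_
  have h1 : Q ^ (k + 1) = 1 := by rw [pow_succ']; exact (sub_eq_zero.mp h).symm
  have h2 := norm_pow_lt hQ (Nat.succ_ne_zero k)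
  rw [Nat.succ_eq_add_one, h1, norm_one] at h2
  exact lt_irrefl _ h2

lemma bdd_of_tendsto {f : ℕ → ℂ} {L : ℂ} (h : Tendsto f atTop (𝓝 L)) :
    ∃ C : ℝ, 0 ≤ C ∧ ∀ n, ‖f n‖ ≤ C := by
  obtain ⟨C, hC⟩ := h.norm.bddAbove_range
  exact ⟨C, (norm_nonneg (f 0)).trans (hC ⟨0, rfl⟩), fun n => hC ⟨n, rfl⟩⟩

lemma gb_eq {Q : ℂ} (hQ : ‖Q‖ < 1) {N k : ℕ} (h : k ≤ N) :
    gb Q N k = qf Q N * ((qf Q k)⁻¹ * (qf Q (N - k))⁻¹) := by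
  have h1 := qf_ne_zero hQ k
  have h2 := qf_ne_zero hQ (N - k)
  rw [← gb_mul Q N k h]; field_simp

lemma gb_bdd {Q : ℂ} (hQ : ‖Q‖ < 1) : ∃ C : ℝ, 0 ≤ C ∧ ∀ N k, ‖gb Q N k‖ ≤ C := by
  have hL := poch_ne_zero_of_norm hQ hQ
  obtain ⟨C, hC0, hC⟩ := bdd_of_tendsto (qf_tendsto hQ)
  obtain ⟨D, hD0, hD⟩ := bdd_of_tendsto ((qf_tendsto hQ).inv₀ hL)
  refine ⟨C * (D * D), by positivity, fun N k => ?_⟩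
  rcases Nat.lt_or_ge N k with h | h
  · rw [gb_gt Q N k h, norm_zero]; positivity
  · rw [gb_eq hQ h, norm_mul, norm_mul]
    exact mul_le_mul (hC _) (mul_le_mul (hD _) (hD _) (norm_nonneg _) hD0) (by positivity) hC0

lemma gb_tendsto {Q : ℂ} (hQ : ‖Q‖ < 1) (j : ℤ) :
    Tendsto (fun n : ℕ => gb Q (2 * n) (j + n).toNat) atTop (𝓝 (qPoch Q Q)⁻¹) := by
  have hL := poch_ne_zero_of_norm hQ hQ
  have t := qf_tendsto hQ
  have t' := t.inv₀ hL
  have a1 : Tendsto (fun n : ℕ => 2 * n) atTop atTop :=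
    tendsto_atTop_mono (fun n => by simp only [id]; omega) tendsto_id
  have a2 : Tendsto (fun n : ℕ => (j + n).toNat) atTop atTop := by
    refine tendsto_atTop.mpr fun b => ?_
    filter_upwards [eventually_ge_atTop (b + j.natAbs)] with n hn
    omega
  have a3 : Tendsto (fun n : ℕ => 2 * n - (j + n).toNat) atTop atTop := by
    refine tendsto_atTop.mpr fun b => ?_
    filter_upwards [eventually_ge_atTop (b + j.natAbs)] with n hn
    omega
  have := (t.comp a1).mul ((t'.comp a2).mul (t'.comp a3))
  have e : qPoch Q Q * ((qPoch Q Q)⁻¹ * (qPoch Q Q)⁻¹) = (qPoch Q Q)⁻¹ := by field_simp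
  rw [e] at this
  refine this.congr' ?_
  filter_upwards [eventually_ge_atTop j.natAbs] with n hn
  rw [gb_eq hQ (by omega)]
  rfl

theorem jtp {q z : ℂ} (hq0 : q ≠ 0) (hq : ‖q‖ < 1) (hz : z ≠ 0) :
    ∑' j : ℤ, q ^ (j ^ 2) * z ^ j =
      qPoch (-(z * q)) (q ^ 2) * qPoch (-(z⁻¹ * q)) (q ^ 2) * qPoch (q ^ 2) (q ^ 2) := by
  have hQ := norm_pow_lt hq two_ne_zero
  have hL := poch_ne_zero_of_norm hQ hQ
  obtain ⟨C, hC0, hC⟩ := gb_bdd hQ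
  let F : ℕ → ℤ → ℂ := fun n j => if -(n : ℤ) ≤ j then
    gb (q ^ 2) (2 * n) (j + n).toNat * (q ^ (j ^ 2) * z ^ j) else 0
  have hF : ∀ n, ∑' j, F n j = (∏ k ∈ Finset.range n, (1 + z * q ^ (2 * k + 1))) *
      (∏ k ∈ Finset.range n, (1 + z⁻¹ * q ^ (2 * k + 1))) := by
    intro n
    rw [finite_jtp hq0 hz, tsum_eq_sum
      (s := (Finset.range (2 * n + 1)).image fun i : ℕ => (i : ℤ) - n), Finset.sum_image]
    · refine Finset.sum_congr rfl fun i _ => ?_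
      simp only [F]
      rw [if_pos (by omega)]
      simp
    · intro a _ b _ h
      simp only at h
      omega
    · intro j hj
      simp only [F]
      split_ifs with h
      · rw [gb_gt, zero_mul]
        by_contra hh
        apply hj
        simp only [Finset.mem_image, Finset.mem_range]
        exact ⟨(j + n).toNat, by omega, by omega⟩
      · rfl
  have hlim1 : Tendsto (fun n => ∑' j, F n j) atTop
      (𝓝 (∑' j : ℤ, (qPoch (q ^ 2) (q ^ 2))⁻¹ * (q ^ (j ^ 2) * z ^ j))) := by
    refine tendsto_tsum_of_dominated_convergence
      (bound := fun j : ℤ => C * ‖q ^ (j ^ 2) * z ^ j‖)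
      ((summable_theta hq0 hq hz).norm.mul_left C) (fun j => ?_) (Eventually.of_forall fun n j => ?_)
    · refine ((gb_tendsto hQ j).mul_const (q ^ (j ^ 2) * z ^ j)).congr' ?_
      filter_upwards [eventually_ge_atTop j.natAbs] with n hn
      simp only [F]
      rw [if_pos (by omega)]
    · simp only [F]
      split_ifs
      · rw [norm_mul]
        exact mul_le_mul_of_nonneg_right (hC _ _) (norm_nonneg _)
      · rw [norm_zero]; positivity
  have hp : ∀ w : ℂ, Tendsto (fun n : ℕ => ∏ k ∈ Finset.range n, (1 + w * q ^ (2 * k + 1))) atTop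
      (𝓝 (qPoch (-(w * q)) (q ^ 2))) := fun w => by
    refine (mult_poch (-(w * q)) hQ).tendsto_prod_tprod_nat.congr fun n => ?_
    refine Finset.prod_congr rfl fun k _ => ?_
    rw [← pow_mul]; ring
  have hlim2 := (hp z).mul (hp z⁻¹)
  have := tendsto_nhds_unique (hlim1.congr hF) hlim2
  rw [tsum_mul_left] at this
  rw [← this]
  field_simp

/-! ### Two-variable theta sums -/

/-- `T r a b = ∑ r^(a j² + b j)` -/
noncomputable def T (r : ℂ) (a b : ℤ) : ℂ := ∑' j : ℤ, r ^ (a * j ^ 2 + b * j)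

lemma norm_zpow_lt {r : ℂ} (hr : ‖r‖ < 1) {a : ℤ} (ha : 0 < a) : ‖r ^ a‖ < 1 := by
  lift a to ℕ using ha.le
  rw [zpow_natCast]
  exact norm_pow_lt hr (by omega)

lemma summable_T {r : ℂ} (hr0 : r ≠ 0) (hr : ‖r‖ < 1) {a : ℤ} (ha : 0 < a) (b : ℤ) :
    Summable fun j : ℤ => r ^ (a * j ^ 2 + b * j) := by
  refine (summable_theta (zpow_ne_zero a hr0) (norm_zpow_lt hr ha) (zpow_ne_zero b hr0)).congr
    fun j => ?_
  rw [zpow_add₀ hr0, zpow_mul, zpow_mul]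

lemma T_prod {r : ℂ} (hr0 : r ≠ 0) (hr : ‖r‖ < 1) (a b c d e : ℕ) (ha : 0 < a)
    (hc : a + b = c) (hd : b + d = a) (he : 2 * a = e) :
    T r a b = qPoch (-(r ^ c)) (r ^ e) * qPoch (-(r ^ d)) (r ^ e) * qPoch (r ^ e) (r ^ e) := by
  have h := jtp (pow_ne_zero a hr0) (norm_pow_lt hr ha.ne') (pow_ne_zero b hr0)
  have e1 : r ^ b * r ^ a = r ^ c := by rw [← pow_add, ← hc, add_comm]
  have e2 : (r ^ b)⁻¹ * r ^ a = r ^ d := by rw [← hd, pow_add]; field_simp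
  have e3 : (r ^ a) ^ 2 = r ^ e := by rw [← pow_mul, ← he, mul_comm]
  rw [e1, e2, e3] at h
  rw [← h, T]
  refine tsum_congr fun j => ?_
  rw [zpow_add₀ hr0, zpow_mul, zpow_mul, zpow_natCast, zpow_natCast]

lemma T_neg (r : ℂ) (a b : ℤ) : T r a (-b) = T r a b := by
  unfold T
  rw [← (Equiv.neg ℤ).tsum_eq]
  exact tsum_congr fun j => by simp

lemma T_shift {r : ℂ} (hr0 : r ≠ 0) (a b : ℤ) : T r a b = r ^ (a + b) * T r a (b + 2 * a) := by
  unfold T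
  rw [← (Equiv.addRight (1 : ℤ)).tsum_eq, ← tsum_mul_left]
  refine tsum_congr fun j => ?_
  rw [← zpow_add₀ hr0, Equiv.coe_addRight]
  congr 1; ring

lemma T_mul {r : ℂ} (hr0 : r ≠ 0) (hr : ‖r‖ < 1) {a c : ℤ} (ha : 0 < a) (hc : 0 < c) (b d : ℤ) :
    T r a b * T r c d =
      ∑' p : ℤ × ℤ, r ^ (a * p.1 ^ 2 + b * p.1 + (c * p.2 ^ 2 + d * p.2)) := by
  unfold T
  rw [tsum_mul_tsum_of_summable_norm (summable_T hr0 hr ha b).norm (summable_T hr0 hr hc d).norm]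
  exact tsum_congr fun p => by rw [zpow_add₀ hr0 (_ + _)]

lemma summable_T_mul {r : ℂ} (hr0 : r ≠ 0) (hr : ‖r‖ < 1) {a c : ℤ} (ha : 0 < a) (hc : 0 < c)
    (b d : ℤ) :
    Summable fun p : ℤ × ℤ => r ^ (a * p.1 ^ 2 + b * p.1 + (c * p.2 ^ 2 + d * p.2)) := by
  refine (summable_mul_of_summable_norm (summable_T hr0 hr ha b).norm
    (summable_T hr0 hr hc d).norm).congr fun p => ?_
  rw [zpow_add₀ hr0 (_ + _)]

/-- `ℤ²` as a union of five cosets of the ideal `(2+i)`. -/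
def gaussEquiv : Fin 5 × (ℤ × ℤ) ≃ ℤ × ℤ where
  toFun p := (2 * p.2.1 + p.2.2 + (p.1 : ℕ), 2 * p.2.2 - p.2.1)
  invFun p := (⟨((p.1 + 2 * p.2) % 5).toNat, by omega⟩,
    (2 * ((p.1 + 2 * p.2) / 5) - p.2, (p.1 + 2 * p.2) / 5))
  left_inv := by
    rintro ⟨⟨c, hc⟩, m, n⟩
    simp only [Prod.mk.injEq, Fin.mk.injEq]
    omega
  right_inv := by
    rintro ⟨a, b⟩
    simp only [Prod.mk.injEq]
    omega

lemma gauss_sum {F : ℤ × ℤ → ℂ} (hF : Summable F) :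
    ∑' p, F p = ∑ c : Fin 5, ∑' p : ℤ × ℤ, F (2 * p.1 + p.2 + (c : ℕ), 2 * p.2 - p.1) := by
  rw [← gaussEquiv.tsum_eq]
  have h : Summable fun p => F (gaussEquiv p) := gaussEquiv.summable_iff.mpr hF
  rw [h.tsum_prod, tsum_fintype]
  rfl

lemma T_gauss {r : ℂ} (hr0 : r ≠ 0) (hr : ‖r‖ < 1) {a : ℤ} (ha : 0 < a) (b : ℤ) :
    T r a b ^ 2 = ∑ c : Fin 5, r ^ (a * (c : ℕ) ^ 2 + b * (c : ℕ)) *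
      (T r (5 * a) (4 * a * (c : ℕ) + b) * T r (5 * a) (2 * a * (c : ℕ) + 3 * b)) := by
  rw [pow_two, T_mul hr0 hr ha ha, gauss_sum (summable_T_mul hr0 hr ha ha b b)]
  refine Finset.sum_congr rfl fun c _ => ?_
  rw [T_mul hr0 hr (by omega) (by omega), ← tsum_mul_left]
  refine tsum_congr fun p => ?_
  rw [← zpow_add₀ hr0]
  congr 1
  ring

lemma phi_id {r : ℂ} (hr0 : r ≠ 0) (hr : ‖r‖ < 1) :
    T r 2 0 ^ 2 = T r 10 0 ^ 2 + 4 * r ^ 2 * (T r 10 8 * T r 10 4) := by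
  rw [T_gauss hr0 hr (by norm_num)]
  have s1 := T_shift hr0 10 (-4)
  have s2 := T_shift hr0 10 4
  have s3 := T_shift hr0 10 (-8)
  have s4 := T_shift hr0 10 12
  rw [T_neg] at s1 s3
  norm_num at s1 s2 s3 s4
  simp only [Fin.sum_univ_five]
  norm_num
  have n1 : ∀ n : ℕ, (r ^ (OfNat.ofNat n : ℤ)) = r ^ n := fun n => zpow_natCast r n
  have k2 : r ^ (2 : ℤ) = r ^ 2 := n1 2
  have k6 : r ^ (6 : ℤ) = r ^ 6 := n1 6
  have k8 : r ^ (8 : ℤ) = r ^ 8 := n1 8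
  have k14 : r ^ (14 : ℤ) = r ^ 14 := n1 14
  have k18 : r ^ (18 : ℤ) = r ^ 18 := n1 18
  have k22 : r ^ (22 : ℤ) = r ^ 22 := n1 22
  have k32 : r ^ (32 : ℤ) = r ^ 32 := n1 32
  simp only [k2, k6, k8, k14, k18, k22, k32] at *
  have t2 : r ^ 8 * (T r 10 16 * T r 10 8) = r ^ 2 * (T r 10 8 * T r 10 4) := by
    rw [s1]; ring
  have t3 : r ^ 18 * (T r 10 24 * T r 10 12) = r ^ 2 * (T r 10 8 * T r 10 4) := by
    rw [s2, s3]; ring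
  have t4 : r ^ 32 * (T r 10 32 * T r 10 16) = r ^ 2 * (T r 10 8 * T r 10 4) := by
    rw [s1, s3, s4]; ring
  linear_combination t2 + t3 + t4

lemma psi_id {r : ℂ} (hr0 : r ≠ 0) (hr : ‖r‖ < 1) :
    T r 1 1 ^ 2 = r ^ 2 * T r 5 5 ^ 2 + 4 * (T r 5 3 * T r 5 1) := by
  rw [T_gauss hr0 hr (by norm_num)]
  have s1 := T_shift hr0 5 (-1)
  have s2 := T_shift hr0 5 (-3)
  have s3 := T_shift hr0 5 3
  have s4 := T_shift hr0 5 1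
  have s5 := T_shift hr0 5 7
  rw [T_neg] at s1 s2
  norm_num at s1 s2 s3 s4 s5
  simp only [Fin.sum_univ_five]
  norm_num
  have n1 : ∀ n : ℕ, (r ^ (OfNat.ofNat n : ℤ)) = r ^ n := fun n => zpow_natCast r n
  have k2 : r ^ (2 : ℤ) = r ^ 2 := n1 2
  have k4 : r ^ (4 : ℤ) = r ^ 4 := n1 4
  have k6 : r ^ (6 : ℤ) = r ^ 6 := n1 6
  have k8 : r ^ (8 : ℤ) = r ^ 8 := n1 8
  have k12 : r ^ (12 : ℤ) = r ^ 12 := n1 12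
  have k20 : r ^ (20 : ℤ) = r ^ 20 := n1 20
  simp only [k2, k4, k6, k8, k12, k20] at *
  have t2 : r ^ 6 * (T r 5 9 * T r 5 7) = T r 5 3 * T r 5 1 := by
    rw [s1, s2]; ring
  have t3 : r ^ 12 * (T r 5 13 * T r 5 9) = T r 5 3 * T r 5 1 := by
    rw [s3, s1]; ring
  have t4 : r ^ 20 * (T r 5 17 * T r 5 11) = T r 5 3 * T r 5 1 := by
    rw [s2, s4, s5]; ring
  linear_combination t2 + t3 + t4

/-! ### The theta-function identity -/

/-- `(q^n; q^n)∞` -/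
noncomputable def f (q : ℂ) (n : ℕ) : ℂ := qPoch (q ^ n) (q ^ n)

lemma f_ne_zero {q : ℂ} (hq : ‖q‖ < 1) {n : ℕ} (hn : n ≠ 0) : f q n ≠ 0 :=
  poch_ne_zero_of_norm (norm_pow_lt hq hn) (norm_pow_lt hq hn)

/-- `f2 = (-q;q) f1`. -/
lemma f_two {q : ℂ} (hq : ‖q‖ < 1) : f q 2 = qPoch (-q) q * f q 1 := by
  rw [f, f, pow_one, poch_neg_mul q hq]

/-- `T 1 1 * f1 = 2 f2²`. -/
lemma psi_prod {r : ℂ} (hr0 : r ≠ 0) (hr : ‖r‖ < 1) :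
    T r 1 1 * f (r ^ 2) 1 = 2 * f (r ^ 2) 2 ^ 2 := by
  have hq := norm_pow_lt hr two_ne_zero
  have h := T_prod hr0 hr 1 1 2 0 2 one_pos rfl rfl rfl
  rw [pow_zero, poch_succ (-1) hq, neg_one_mul] at h
  have e : f (r ^ 2) 1 = qPoch (r ^ 2) (r ^ 2) := by rw [f, pow_one]
  rw [f_two hq, e]
  norm_cast at h ⊢
  rw [h]
  push_cast
  ring

/-- `φ(q) = (-q;q²)² f2`. -/
lemma phi_prod {r : ℂ} (hr0 : r ≠ 0) (hr : ‖r‖ < 1) :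
    T r 2 0 = qPoch (-(r ^ 2)) (r ^ 4) ^ 2 * f (r ^ 2) 2 := by
  have h := T_prod hr0 hr 2 0 2 2 4 two_pos rfl rfl rfl
  rw [f, ← pow_mul]
  norm_cast at h ⊢
  rw [h]; ring

/-- `ψ(q)² = φ(q) ψ(q²)`. -/
lemma psi_sq {r : ℂ} (hr0 : r ≠ 0) (hr : ‖r‖ < 1) :
    T r 1 1 ^ 2 = 2 * (T r 2 0 * T (r ^ 2) 1 1) := by
  have hr2 := norm_pow_lt hr two_ne_zero
  have h1 := psi_prod hr0 hr
  have h2 := psi_prod (pow_ne_zero 2 hr0) hr2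
  have h3 := phi_prod hr0 hr
  have n1 := f_ne_zero hr2 one_ne_zero
  have n2 := f_ne_zero hr2 two_ne_zero
  have s1 := f_two hr2
  have s2 := poch_split (-(r ^ 2)) hr2
  have s3 := f_two (norm_pow_lt hr2 two_ne_zero)
  have e1 : f ((r ^ 2) ^ 2) 1 = f (r ^ 2) 2 := by simp only [f]; rw [pow_one]
  have e2 : -r ^ 2 * r ^ 2 = -((r ^ 2) ^ 2) := by ring
  have e3 : (r ^ 2) ^ 2 = r ^ 4 := by ring
  rw [e1] at h2 s3
  rw [e2, e3] at s2
  rw [e3] at h2 s3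
  -- write everything with `A = (-q;q²)`, `B = (-q²;q²)`
  rw [← s2] at s1
  have h4 : T r 1 1 = 2 * f (r ^ 2) 2 * (qPoch (-(r ^ 2)) (r ^ 4) * qPoch (-(r ^ 4)) (r ^ 4)) := by
    apply mul_right_cancel₀ n1
    rw [h1]; linear_combination 2 * f (r ^ 2) 2 * s1
  have h5 : T (r ^ 2) 1 1 = 2 * qPoch (-(r ^ 4)) (r ^ 4) ^ 2 * f (r ^ 2) 2 := by
    apply mul_right_cancel₀ n2
    rw [h2, s3]; ring
  rw [h4, h3, h5]; ring

lemma five_prod_a {r : ℂ} (hr0 : r ≠ 0) (hr : ‖r‖ < 1) :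
    T r 10 8 * T (r ^ 2) 5 1 * f (r ^ 2) 5 = T r 5 3 * f (r ^ 2) 10 ^ 2 := by
  have hr2 := norm_pow_lt hr two_ne_zero
  have hr10 := norm_pow_lt hr (show 10 ≠ 0 by norm_num)
  have a1 := T_prod hr0 hr 10 8 18 2 20 (by norm_num) rfl rfl rfl
  have a2 := T_prod (pow_ne_zero 2 hr0) hr2 5 1 6 4 10 (by norm_num) rfl rfl rfl
  have a3 := T_prod hr0 hr 5 3 8 2 10 (by norm_num) rfl rfl rfl
  have s1 := poch_split (-(r ^ 2)) hr10
  have s2 := poch_split (-(r ^ 8)) hr10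
  simp only [← pow_mul, neg_mul, ← pow_add] at a1 a2 a3 s1 s2
  norm_num at a1 a2 a3 s1 s2
  have e1 : f (r ^ 2) 5 = qPoch (r ^ 10) (r ^ 10) := by rw [f, ← pow_mul]
  have e2 : f (r ^ 2) 10 = qPoch (r ^ 20) (r ^ 20) := by rw [f, ← pow_mul]
  rw [a1, a2, a3, e1, e2, ← s1, ← s2]
  ring

lemma five_prod_b {r : ℂ} (hr0 : r ≠ 0) (hr : ‖r‖ < 1) :
    T r 10 4 * T (r ^ 2) 5 3 * f (r ^ 2) 5 = T r 5 1 * f (r ^ 2) 10 ^ 2 := by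
  have hr2 := norm_pow_lt hr two_ne_zero
  have hr10 := norm_pow_lt hr (show 10 ≠ 0 by norm_num)
  have a1 := T_prod hr0 hr 10 4 14 6 20 (by norm_num) rfl rfl rfl
  have a2 := T_prod (pow_ne_zero 2 hr0) hr2 5 3 8 2 10 (by norm_num) rfl rfl rfl
  have a3 := T_prod hr0 hr 5 1 6 4 10 (by norm_num) rfl rfl rfl
  have s1 := poch_split (-(r ^ 4)) hr10
  have s2 := poch_split (-(r ^ 6)) hr10
  simp only [← pow_mul, neg_mul, ← pow_add] at a1 a2 a3 s1 s2
  norm_num at a1 a2 a3 s1 s2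
  have e1 : f (r ^ 2) 5 = qPoch (r ^ 10) (r ^ 10) := by rw [f, ← pow_mul]
  have e2 : f (r ^ 2) 10 = qPoch (r ^ 20) (r ^ 20) := by rw [f, ← pow_mul]
  rw [a1, a2, a3, e1, e2, ← s1, ← s2]
  ring

lemma T_pow (r : ℂ) (k : ℕ) (a b : ℤ) : T (r ^ k) a b = T r (k * a) (k * b) := by
  unfold T
  refine tsum_congr fun j => ?_
  rw [← zpow_natCast, ← zpow_mul]
  congr 1; ring

lemma psi5_prod {r : ℂ} (hr0 : r ≠ 0) (hr : ‖r‖ < 1) :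
    T (r ^ 5) 1 1 * f (r ^ 2) 5 = 2 * f (r ^ 2) 10 ^ 2 := by
  have h := psi_prod (pow_ne_zero 5 hr0) (norm_pow_lt hr (show 5 ≠ 0 by norm_num))
  have e1 : f ((r ^ 5) ^ 2) 1 = f (r ^ 2) 5 := by
    simp only [f]; rw [pow_one]; congr 1 <;> ring
  have e2 : f ((r ^ 5) ^ 2) 2 = f (r ^ 2) 10 := by
    simp only [f]; congr 1 <;> ring
  rwa [e1, e2] at h

/-- The key product identity. -/
lemma key {r : ℂ} (hr0 : r ≠ 0) (hr : ‖r‖ < 1) :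
    (T r 2 0 ^ 2 - T r 10 0 ^ 2) * (T (r ^ 2) 1 1 ^ 2 - r ^ 4 * T (r ^ 10) 1 1 ^ 2) =
      r ^ 2 * T (r ^ 5) 1 1 ^ 2 * (T r 1 1 ^ 2 - r ^ 2 * T (r ^ 5) 1 1 ^ 2) := by
  have hr2 := norm_pow_lt hr two_ne_zero
  have i1 := phi_id hr0 hr
  have i2 := psi_id hr0 hr
  have i3 := psi_id (pow_ne_zero 2 hr0) hr2
  have e1 : T (r ^ 5) 1 1 = T r 5 5 := by rw [T_pow]; norm_num
  have e2 : T (r ^ 10) 1 1 = T (r ^ 2) 5 5 := by rw [T_pow, T_pow]; norm_num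
  have pa := five_prod_a hr0 hr
  have pb := five_prod_b hr0 hr
  have pc := psi5_prod hr0 hr
  have n5 : f (r ^ 2) 5 ≠ 0 := f_ne_zero hr2 (by norm_num)
  rw [e1] at pc
  rw [e2, e1, i1, i2, i3]
  apply mul_right_cancel₀ (pow_ne_zero 2 n5)
  calc _ = 16 * r ^ 2 * (T r 10 8 * T (r ^ 2) 5 1 * f (r ^ 2) 5) *
        (T r 10 4 * T (r ^ 2) 5 3 * f (r ^ 2) 5) := by ring
    _ = 4 * r ^ 2 * (T r 5 3 * T r 5 1) * (2 * f (r ^ 2) 10 ^ 2) ^ 2 := by rw [pa, pb]; ring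
    _ = _ := by rw [← pc]; ring

lemma U_eq {r : ℂ} (hr0 : r ≠ 0) (hr : ‖r‖ < 1) :
    r * (f (r ^ 2) 1 * f (r ^ 2) 10 ^ 2) / (f (r ^ 2) 2 ^ 2 * f (r ^ 2) 5) =
      r * T (r ^ 5) 1 1 / T r 1 1 ∧ T r 1 1 ≠ 0 := by
  have hr2 := norm_pow_lt hr two_ne_zero
  have n1 : f (r ^ 2) 1 ≠ 0 := f_ne_zero hr2 (by norm_num)
  have n2 : f (r ^ 2) 2 ≠ 0 := f_ne_zero hr2 (by norm_num)
  have n5 : f (r ^ 2) 5 ≠ 0 := f_ne_zero hr2 (by norm_num)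
  have h1 := psi_prod hr0 hr
  have h5 := psi5_prod hr0 hr
  have n : T r 1 1 ≠ 0 := by
    intro h
    rw [h, zero_mul] at h1
    exact (mul_ne_zero two_ne_zero (pow_ne_zero 2 n2)) h1.symm
  refine ⟨?_, n⟩
  rw [div_eq_div_iff (by positivity) n]
  linear_combination r * f (r ^ 2) 10 ^ 2 * h1 - r * f (r ^ 2) 2 ^ 2 * h5

lemma final {r : ℂ} (hr0 : r ≠ 0) (hr : ‖r‖ < 1) (u v : ℂ)
    (hu : u = r * T (r ^ 5) 1 1 / T r 1 1)
    (hv : v = r ^ 2 * T ((r ^ 2) ^ 5) 1 1 / T (r ^ 2) 1 1) :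
    u ^ 4 + 4 * u ^ 2 * v ^ 2 + v ^ 4 = v ^ 2 * (1 + 5 * u ^ 4) := by
  have hr2 := norm_pow_lt hr two_ne_zero
  have hr5 := norm_pow_lt hr (show 5 ≠ 0 by norm_num)
  have nψ := (U_eq hr0 hr).2
  have ns := (U_eq (pow_ne_zero 2 hr0) hr2).2
  have k := key hr0 hr
  have q1 := psi_sq hr0 hr
  have q5 := psi_sq (pow_ne_zero 5 hr0) hr5
  have e1 : (r ^ 2) ^ 5 = r ^ 10 := by ring
  have e2 : (r ^ 5) ^ 2 = r ^ 10 := by ring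
  have e3 : T (r ^ 5) 2 0 = T r 10 0 := by rw [T_pow]; norm_num
  rw [e2, e3] at q5
  rw [e1] at hv
  have np : T r 2 0 ≠ 0 := by
    intro h
    rw [h, zero_mul, mul_zero] at q1
    exact (pow_ne_zero 2 nψ) q1
  rw [q1, q5] at k
  generalize T r 2 0 = p at *
  generalize T r 10 0 = P at *
  generalize T (r ^ 2) 1 1 = s at *
  generalize T (r ^ 10) 1 1 = S at *
  have hu2 : u ^ 2 = r ^ 2 * (P * S) / (p * s) := by
    rw [hu, div_pow, mul_pow, q1, q5]
    field_simp
  have hu4 : u ^ 4 = (r ^ 2 * (P * S) / (p * s)) ^ 2 := by rw [← hu2]; ring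
  rw [hu4, hu2, hv]
  field_simp
  linear_combination (-S ^ 2) * k

end ThetaAux

/-- Modular equation of level two for `U`: for every `τ ∈ ℍ`,
`U(τ)⁴ + 4U(τ)²U(2τ)² + U(2τ)⁴ = U(2τ)²·(1 + 5U(τ)⁴)`. -/
theorem statement14 (τ : UpperHalfPlane) :
    Ufun τ ^ 4 + 4 * Ufun τ ^ 2 * Ufun (dbl τ) ^ 2 + Ufun (dbl τ) ^ 4 =
      Ufun (dbl τ) ^ 2 * (1 + 5 * Ufun τ ^ 4) := by
  have hU : ∀ σ : UpperHalfPlane, ∀ r : ℂ, r = Complex.exp (Real.pi * Complex.I * σ) →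
      Ufun σ = r * ThetaAux.T (r ^ 5) 1 1 / ThetaAux.T r 1 1 ∧ r ≠ 0 ∧ ‖r‖ < 1 := by
    intro σ r hr
    have hr0 : r ≠ 0 := hr ▸ Complex.exp_ne_zero _
    have hr1 : ‖r‖ < 1 := by
      rw [hr, Complex.norm_exp, Real.exp_lt_one_iff]
      have := mul_pos Real.pi_pos σ.im_pos
      simpa using this
    have hq : Qc σ = r ^ 2 := by
      rw [Qc, hr, ← Complex.exp_nat_mul]
      congr 1; push_cast; ring
    refine ⟨?_, hr0, hr1⟩
    rw [← (ThetaAux.U_eq hr0 hr1).1, Ufun, hq, ← hr]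
    simp only [ThetaAux.f, pow_one]
  obtain ⟨h1, hr0, hr1⟩ := hU τ _ rfl
  have e : Complex.exp (Real.pi * Complex.I * τ) ^ 2 =
      Complex.exp (Real.pi * Complex.I * (dbl τ : UpperHalfPlane)) := by
    rw [← Complex.exp_nat_mul]
    congr 1
    simp only [dbl]
    push_cast; ring_nf
  obtain ⟨h2, -, -⟩ := hU (dbl τ) _ e
  exact ThetaAux.final hr0 hr1 _ _ h1 h2
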